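/- arXiv:2004.03486 — 8 statements merged into one kernel-verified Lean document; each statement's English description precedes it below -/
import Mathlib

section
/- Combinatorial core of the Δ-approximation theorem: let ℓ : ℕ → ℝ be antitone with 0 ≤ ℓ i for all i, let k, Δ, n ∈ ℕ with 2 ≤ k and 1 ≤ Δ, and let c : ℕ → ℕ satisfy ∑_{i ∈ range n} c i ≤ k * Δ. Then (k / 2) * ∑_{i ∈ range n, 2 ≤ c i} ℓ i ≤ ((k * Δ) / 2) * ∑_{i ∈ range (k/2)} ℓ i, where / denotes natural-number (floor) division. (Interpretation: if an optimal set of k portals, each lying on at most Δ trajectories, captures the trajectories i with c i ≥ 2 clones, then the captured length is at most ⌊kΔ/2⌋/⌊k/2⌋ times the length captured by the greedy algorithm that places portals at both endpoints of the ⌊k/2⌋ longest trajectories; this ratio is Δ for even k and at most Δ(1+1/(k-1)) for odd k.) -/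
/-- If a finite index set has at most `M` elements and `m ≤ M`, then its sum under a nonincreasing
nonnegative sequence is at most `M / m` times the sum of the first `m` terms. -/
theorem Antitone.mul_sum_le_mul_sum_range {f : ℕ → ℝ} (hf : Antitone f) (h0 : ∀ i, 0 ≤ f i)
    {S : Finset ℕ} {m M : ℕ} (hS : S.card ≤ M) (hm : m ≤ M) :
    (m : ℝ) * ∑ i ∈ S, f i ≤ (M : ℝ) * ∑ i ∈ Finset.range m, f i := by
  have excess_le : ∑ i ∈ S, (f i - f m) ≤ ∑ i ∈ Finset.range m, (f i - f m) := by
    calc ∑ i ∈ S, (f i - f m) ≤ ∑ i ∈ S, if i < m then f i - f m else 0 := by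
          refine Finset.sum_le_sum fun i _ => ?_
          split_ifs with hi
          · exact le_rfl
          · exact sub_nonpos.2 (hf (not_lt.1 hi))
      _ = ∑ i ∈ S with i < m, (f i - f m) := (Finset.sum_filter _ _).symm
      _ ≤ ∑ i ∈ Finset.range m, (f i - f m) := by
          refine Finset.sum_le_sum_of_subset_of_nonneg (fun i hi => ?_) fun i hi _ => ?_
          · exact Finset.mem_range.2 (Finset.mem_filter.1 hi).2
          · exact sub_nonneg.2 (hf (Finset.mem_range.1 hi).le)
  have range_ge : (m : ℝ) * f m ≤ ∑ i ∈ Finset.range m, f i := by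
    simpa using Finset.card_nsmul_le_sum (Finset.range m) f (f m)
      fun i hi => hf (Finset.mem_range.1 hi).le
  simp only [Finset.sum_sub_distrib, Finset.sum_const, Finset.card_range, nsmul_eq_mul]
    at excess_le
  have card_mul_le : (S.card : ℝ) * f m ≤ M * f m :=
    mul_le_mul_of_nonneg_right (by exact_mod_cast hS) (h0 m)
  have sum_le : ∑ i ∈ S, f i ≤ ∑ i ∈ Finset.range m, f i + ((M : ℝ) - m) * f m := by
    linarith
  have hm' : (0 : ℝ) ≤ (M : ℝ) - m := sub_nonneg.2 (by exact_mod_cast hm)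
  calc (m : ℝ) * ∑ i ∈ S, f i
      ≤ m * (∑ i ∈ Finset.range m, f i + ((M : ℝ) - m) * f m) := by gcongr
    _ = m * ∑ i ∈ Finset.range m, f i + ((M : ℝ) - m) * (m * f m) := by ring
    _ ≤ m * ∑ i ∈ Finset.range m, f i + ((M : ℝ) - m) * ∑ i ∈ Finset.range m, f i := by gcongr
    _ = M * ∑ i ∈ Finset.range m, f i := by ring

/-- Combinatorial core of the Δ-approximation theorem: if the clone counts
`c i` sum to at most `k * Δ`, then the total length of trajectories receiving
at least two clones is at most `⌊kΔ/2⌋ / ⌊k/2⌋` times the total length of the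
`⌊k/2⌋` longest trajectories. -/
theorem delta_approximation_core (ℓ : ℕ → ℝ) (hmono : Antitone ℓ) (hnonneg : ∀ i, 0 ≤ ℓ i)
    (k Δ n : ℕ) (hk : 2 ≤ k) (hΔ : 1 ≤ Δ) (c : ℕ → ℕ)
    (hc : ∑ i ∈ Finset.range n, c i ≤ k * Δ) :
    ((k / 2 : ℕ) : ℝ) * ∑ i ∈ (Finset.range n).filter (fun i => 2 ≤ c i), ℓ i
      ≤ (((k * Δ) / 2 : ℕ) : ℝ) * ∑ i ∈ Finset.range (k / 2), ℓ i := by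
  refine hmono.mul_sum_le_mul_sum_range hnonneg ?_
    (Nat.div_le_div_right (Nat.le_mul_of_pos_right k hΔ))
  rw [Nat.le_div_iff_mul_le two_pos]
  calc ((Finset.range n).filter (fun i => 2 ≤ c i)).card * 2
      ≤ ∑ i ∈ (Finset.range n).filter (fun i => 2 ≤ c i), c i := by
        simpa using Finset.card_nsmul_le_sum _ c 2 fun i hi => (Finset.mem_filter.1 hi).2
    _ ≤ ∑ i ∈ Finset.range n, c i := Finset.sum_le_sum_of_subset (Finset.filter_subset _ _)
    _ ≤ k * Δ := hc
end

section
/- Let n be a positive integer divisible by 4, and define p : Fin n → EuclideanSpace ℝ (Fin 2) by p j = ((1/2)·cos(2πj/n), (1/2)·sin(2πj/n)). Then for every i : Fin n, the number of indices j : Fin n with dist (p i) (p j) ≥ √2 / 2 is at least n / 2. -/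
open Real

/-- Two points of the circle of radius `1 / 2` whose angles differ by an angle of nonpositive
cosine are at distance at least `√2 / 2`. -/
lemma sqrt_two_div_two_le_dist_of_cos_nonpos {x y : EuclideanSpace ℝ (Fin 2)} {a b : ℝ}
    (hx : x = ![(1 / 2) * Real.cos a, (1 / 2) * Real.sin a])
    (hy : y = ![(1 / 2) * Real.cos b, (1 / 2) * Real.sin b])
    (hab : Real.cos (a - b) ≤ 0) : Real.sqrt 2 / 2 ≤ dist x y := by
  have hx0 := congrFun hx 0
  have hx1 := congrFun hx 1
  have hy0 := congrFun hy 0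
  have hy1 := congrFun hy 1
  simp only [Matrix.cons_val_zero, Matrix.cons_val_one] at hx0 hx1 hy0 hy1
  rw [EuclideanSpace.dist_eq, Fin.sum_univ_two, Real.dist_eq, Real.dist_eq, sq_abs, sq_abs,
    hx0, hx1, hy0, hy1]
  apply Real.le_sqrt_of_sq_le
  rw [div_pow, Real.sq_sqrt zero_le_two]
  rw [Real.cos_sub] at hab
  nlinarith [Real.sin_sq_add_cos_sq a, Real.sin_sq_add_cos_sq b]

/-- The angle from the `i`-th to the `(i + m + k)`-th of `4 * m` evenly spaced points has
nonpositive cosine when `k ≤ 2 * m`. -/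
lemma cos_sub_add_mod_nonpos {m k : ℕ} (hm : 0 < m) (hk : k ≤ 2 * m) (i : ℕ) :
    Real.cos (2 * Real.pi * (i : ℝ) / (4 * m : ℕ) -
      2 * Real.pi * (((i + m + k) % (4 * m) : ℕ) : ℝ) / (4 * m : ℕ)) ≤ 0 := by
  have hm' : (0 : ℝ) < m := by exact_mod_cast hm
  have hmod : (((i + m + k) % (4 * m) : ℕ) : ℝ) =
      i + m + k - 4 * m * ((i + m + k) / (4 * m) : ℕ) := by
    rw [eq_sub_iff_add_eq]
    exact_mod_cast Nat.mod_add_div (i + m + k) (4 * m)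
  have hangle : 2 * Real.pi * (i : ℝ) / (4 * m : ℕ) -
      2 * Real.pi * (((i + m + k) % (4 * m) : ℕ) : ℝ) / (4 * m : ℕ) =
      -(Real.pi * k / (2 * m) + Real.pi / 2) +
        ((i + m + k) / (4 * m) : ℕ) * (2 * Real.pi) := by
    rw [hmod]
    generalize (i + m + k) / (4 * m) = q
    push_cast
    field_simp
    ring
  rw [hangle, Real.cos_add_nat_mul_two_pi, Real.cos_neg, Real.cos_add_pi_div_two, neg_nonpos]
  apply Real.sin_nonneg_of_nonneg_of_le_pi (by positivity)
  rw [div_le_iff₀ (by positivity)]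
  gcongr
  exact_mod_cast hk

/-- For `n` divisible by 4 evenly spaced points on the circle of diameter 1,
every point has at least `n / 2` points at distance at least `√2 / 2`. -/
theorem many_long_chords (n : ℕ) (hn : 0 < n) (h4 : 4 ∣ n)
    (p : Fin n → EuclideanSpace ℝ (Fin 2))
    (hp : ∀ j : Fin n, p j =
      ![(1 / 2) * Real.cos (2 * Real.pi * (j : ℝ) / n),
        (1 / 2) * Real.sin (2 * Real.pi * (j : ℝ) / n)])
    (i : Fin n) :
    n / 2 ≤ (Finset.univ.filter
      (fun j : Fin n => Real.sqrt 2 / 2 ≤ dist (p i) (p j))).card := by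
  obtain ⟨m, rfl⟩ := h4
  have hm : 0 < m := by omega
  rw [← Finset.card_range (4 * m / 2)]
  refine Finset.card_le_card_of_injOn (fun k => ⟨(i + m + k) % (4 * m), Nat.mod_lt _ hn⟩) ?_ ?_
  · intro k hk
    have hk' := Finset.mem_range.1 hk
    simp only [Finset.coe_filter, Finset.mem_univ, true_and, Set.mem_ofPred_eq]
    exact sqrt_two_div_two_le_dist_of_cos_nonpos (hp i) (hp _)
      (cos_sub_add_mod_nonpos hm (by omega) i)
  · intro k hk l hl hkl
    have hk' := Finset.mem_range.1 hk
    have hl' := Finset.mem_range.1 hl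
    have hmod : i + m + k ≡ i + m + l [MOD 4 * m] := congrArg Fin.val hkl
    exact (Nat.ModEq.add_left_cancel' _ hmod).eq_of_lt_of_lt (by omega) (by omega)
end

section
/- Let n be a positive integer divisible by 4, and define p : Fin n → EuclideanSpace ℝ (Fin 2) by p j = ((1/2)·cos(2πj/n), (1/2)·sin(2πj/n)). Then ∑_{(i,j) ∈ (Finset.univ : Finset (Fin n)).offDiag} dist (p i) (p j) ≥ n² / 4; equivalently, the total length of all chords between pairs of distinct points p i, p j (each unordered pair counted once) is at least n² / 8. -/
/-- The `n`-th roots of unity sum to zero, in real coordinates. -/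
lemma sum_cos_sin_two_pi_mul_div_eq_zero {n : ℕ} (hn : 1 < n) :
    ∑ j : Fin n, Real.cos (2 * Real.pi * (j : ℝ) / n) = 0 ∧
      ∑ j : Fin n, Real.sin (2 * Real.pi * (j : ℝ) / n) = 0 := by
  have hsum := (Complex.isPrimitiveRoot_exp n (by omega)).geom_sum_eq_zero hn
  rw [← Fin.sum_univ_eq_sum_range] at hsum
  have hpow (j : Fin n) : Complex.exp (2 * Real.pi * Complex.I / n) ^ (j : ℕ) =
      Complex.exp ((2 * Real.pi * (j : ℝ) / n : ℝ) * Complex.I) := by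
    rw [← Complex.exp_nat_mul]
    congr 1
    push_cast
    ring
  simp_rw [hpow] at hsum
  constructor
  · simpa only [Complex.re_sum, Complex.exp_ofReal_mul_I_re, Complex.zero_re]
      using congrArg Complex.re hsum
  · simpa only [Complex.im_sum, Complex.exp_ofReal_mul_I_im, Complex.zero_im]
      using congrArg Complex.im hsum

/-- The distances from a point to the members of a finite family with sum zero add up to at least
the size of the family times the norm of the point. -/
lemma card_mul_norm_le_sum_dist {ι E : Type*} [Fintype ι] [NormedAddCommGroup E] [NormedSpace ℝ E]
    {p : ι → E} (hp : ∑ j, p j = 0) (x : E) :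
    (Fintype.card ι : ℝ) * ‖x‖ ≤ ∑ j, dist x (p j) := by
  calc (Fintype.card ι : ℝ) * ‖x‖ = ‖∑ j, (x - p j)‖ := by
        rw [Finset.sum_sub_distrib, hp, sub_zero, Finset.sum_const, Finset.card_univ,
          ← Nat.cast_smul_eq_nsmul ℝ, norm_smul, Real.norm_natCast]
    _ ≤ ∑ j, ‖x - p j‖ := norm_sum_le _ _
    _ = ∑ j, dist x (p j) := by simp_rw [dist_eq_norm]

/-- For `n` divisible by 4 evenly spaced points on the circle of diameter 1,
the total length of all chords (each ordered pair of distinct indices counted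
once, i.e., each unordered pair twice) is at least `n² / 4`. -/
theorem total_chord_length_lower_bound (n : ℕ) (hn : 0 < n) (h4 : 4 ∣ n)
    (p : Fin n → EuclideanSpace ℝ (Fin 2))
    (hp : ∀ j : Fin n, p j =
      ![(1 / 2) * Real.cos (2 * Real.pi * (j : ℝ) / n),
        (1 / 2) * Real.sin (2 * Real.pi * (j : ℝ) / n)]) :
    (n : ℝ) ^ 2 / 4 ≤
      ∑ ij ∈ (Finset.univ : Finset (Fin n)).offDiag, dist (p ij.1) (p ij.2) := by
  have hp0 (j : Fin n) : p j 0 = (1 / 2) * Real.cos (2 * Real.pi * (j : ℝ) / n) := by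
    simpa using congrFun (hp j) 0
  have hp1 (j : Fin n) : p j 1 = (1 / 2) * Real.sin (2 * Real.pi * (j : ℝ) / n) := by
    simpa using congrFun (hp j) 1
  obtain ⟨hcos, hsin⟩ := sum_cos_sin_two_pi_mul_div_eq_zero
    (show 1 < n by have := Nat.le_of_dvd hn h4; omega)
  have hsum : ∑ j, p j = 0 := by
    ext k
    fin_cases k
    · simp [hp0, ← Finset.mul_sum, hcos]
    · simp [hp1, ← Finset.mul_sum, hsin]
  have hnorm (j : Fin n) : ‖p j‖ = 1 / 2 := by
    rw [EuclideanSpace.norm_eq, Real.sqrt_eq_iff_mul_self_eq (by positivity) (by norm_num)]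
    simp only [Fin.sum_univ_two, Real.norm_eq_abs, sq_abs, hp0, hp1]
    linarith [Real.sin_sq_add_cos_sq (2 * Real.pi * (j : ℝ) / n)]
  have hdiag : ∑ ij ∈ (Finset.univ : Finset (Fin n)).offDiag, dist (p ij.1) (p ij.2) =
      ∑ i, ∑ j, dist (p i) (p j) := by
    rw [← Fintype.sum_prod_type']
    refine Finset.sum_subset (Finset.subset_univ _) fun ij _ hij => ?_
    have : ij.1 = ij.2 := by simpa using hij
    rw [this, dist_self]
  rw [hdiag]
  calc (n : ℝ) ^ 2 / 4 ≤ ∑ i : Fin n, (n : ℝ) * ‖p i‖ := by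
        simp only [hnorm, Finset.sum_const, Finset.card_univ, Fintype.card_fin, nsmul_eq_mul]
        nlinarith [sq_nonneg (n : ℝ)]
    _ ≤ ∑ i, ∑ j, dist (p i) (p j) := Finset.sum_le_sum fun i _ => by
        simpa using card_mul_norm_le_sum_dist hsum (p i)
end

section
/- Let o be a point of the Euclidean plane EuclideanSpace ℝ (Fin 2), r > 0, and u : Fin n → EuclideanSpace ℝ (Fin 2) an injective map with u i ∈ Metric.sphere o r for all i. Then for any two distinct points p ≠ q of the plane, the number of ordered pairs (i, j) of distinct indices such that both p and q lie in segment ℝ (u i) (u j) is at most 2 (i.e., at most one unordered chord of the configuration contains both p and q). -/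
/-- A line spanned by two distinct points of a segment contains both endpoints of the segment. -/
theorem endpoints_mem_affineSpan_of_mem_segment {E : Type*} [AddCommGroup E] [Module ℝ E]
    {a b p q : E} (hpq : p ≠ q) (hp : p ∈ segment ℝ a b) (hq : q ∈ segment ℝ a b) :
    a ∈ line[ℝ, p, q] ∧ b ∈ line[ℝ, p, q] := by
  have hcol : Collinear ℝ {p, q, a, b} :=
    collinear_insert_insert_of_mem_affineSpan_pair
      (mem_segment_iff_wbtw.1 hp).mem_affineSpan (mem_segment_iff_wbtw.1 hq).mem_affineSpan
  exact ⟨hcol.mem_affineSpan_of_mem_of_ne (by simp) (by simp) (by simp) hpq,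
    hcol.mem_affineSpan_of_mem_of_ne (by simp) (by simp) (by simp) hpq⟩

/-- A line meets a sphere in at most two points. -/
theorem eq_or_eq_of_mem_sphere_of_mem_affineSpan_pair {E : Type*} [NormedAddCommGroup E]
    [InnerProductSpace ℝ E] {o a b c p q : E} {r : ℝ} (ha : a ∈ Metric.sphere o r)
    (hb : b ∈ Metric.sphere o r) (hc : c ∈ Metric.sphere o r) (hal : a ∈ line[ℝ, p, q])
    (hbl : b ∈ line[ℝ, p, q]) (hcl : c ∈ line[ℝ, p, q]) (hab : a ≠ b) : c = a ∨ c = b := by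
  by_contra! h
  have hcos : EuclideanGeometry.Cospherical (Metric.sphere o r) := ⟨o, r, fun _ hx => hx⟩
  exact affineIndependent_iff_not_collinear_set.1
    (hcos.affineIndependent_of_mem_of_ne ha hb hc hab h.1.symm h.2.symm)
    (collinear_triple_of_mem_affineSpan_pair hal hbl hcl)


open scoped Classical in
/-- For `n` distinct points on a circle, any two distinct points of the plane
lie together on at most one unordered chord of the configuration, i.e., on at
most 2 ordered pairs of distinct indices. -/
theorem pair_captures_at_most_one_chord
    (n : ℕ) (o : EuclideanSpace ℝ (Fin 2)) (r : ℝ) (hr : 0 < r)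
    (u : Fin n → EuclideanSpace ℝ (Fin 2)) (hu : Function.Injective u)
    (husph : ∀ i, u i ∈ Metric.sphere o r)
    (p q : EuclideanSpace ℝ (Fin 2)) (hpq : p ≠ q) :
    ((Finset.univ : Finset (Fin n)).offDiag.filter
      (fun ij => p ∈ segment ℝ (u ij.1) (u ij.2) ∧
                 q ∈ segment ℝ (u ij.1) (u ij.2))).card ≤ 2 := by
  rcases Finset.eq_empty_or_nonempty ((Finset.univ : Finset (Fin n)).offDiag.filter
      (fun ij => p ∈ segment ℝ (u ij.1) (u ij.2) ∧
                 q ∈ segment ℝ (u ij.1) (u ij.2))) with h | ⟨⟨i, j⟩, h⟩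
  · simp [h]
  · simp only [Finset.mem_filter, Finset.mem_offDiag, Finset.mem_univ, true_and] at h
    obtain ⟨hij, hp, hq⟩ := h
    obtain ⟨hi, hj⟩ := endpoints_mem_affineSpan_of_mem_segment hpq hp hq
    have hline (k : Fin n) (hk : u k ∈ line[ℝ, p, q]) : k = i ∨ k = j :=
      (eq_or_eq_of_mem_sphere_of_mem_affineSpan_pair (husph i) (husph j) (husph k) hi hj hk
        (hu.ne hij)).imp (fun e => hu e) (fun e => hu e)
    refine (Finset.card_le_card (t := {(i, j), (j, i)}) ?_).trans Finset.card_le_two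
    rintro ⟨k, l⟩ hkl
    simp only [Finset.mem_filter, Finset.mem_offDiag, Finset.mem_univ, true_and] at hkl
    obtain ⟨hkl, hp', hq'⟩ := hkl
    obtain ⟨hk, hl⟩ := endpoints_mem_affineSpan_of_mem_segment hpq hp' hq'
    rcases hline k hk with rfl | rfl <;> rcases hline l hl with rfl | rfl <;> simp_all
end

section
/- Integral optimum bound in the integrality-gap construction: let o be a point of the Euclidean plane EuclideanSpace ℝ (Fin 2) and u : Fin n → EuclideanSpace ℝ (Fin 2) an injective map with u i ∈ Metric.sphere o (1/2) for all i (n distinct points on a circle of diameter 1). Then for every finset P of points of the plane with P.card = k, ∑_{(i,j) ∈ offDiag, the chord segment ℝ (u i) (u j) contains at least two points of P} dist (u i) (u j) ≤ k * (k − 1); equivalently, the total length of chords captured by any k portals (each unordered chord counted once) is at most k(k−1)/2 < k². -/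
/-- A quadratic polynomial with nonzero leading coefficient which vanishes at two distinct points
vanishes nowhere else. -/
lemma eq_or_eq_of_quadratic_eq {A B C x₁ x₂ y : ℝ} (hA : A ≠ 0) (hx : x₁ ≠ x₂)
    (h₁ : A * x₁ ^ 2 + B * x₁ + C = 0) (h₂ : A * x₂ ^ 2 + B * x₂ + C = 0)
    (hy : A * y ^ 2 + B * y + C = 0) : y = x₁ ∨ y = x₂ := by
  have hB : A * (x₁ + x₂) + B = 0 := by
    refine (mul_eq_zero.mp ?_).resolve_left (sub_ne_zero.mpr hx)
    linear_combination h₁ - h₂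
  have h : A * ((y - x₁) * (y - x₂)) = 0 := by
    linear_combination hy - h₁ - (y - x₁) * hB
  rcases mul_eq_zero.mp ((mul_eq_zero.mp h).resolve_left hA) with h | h
  · exact Or.inl (sub_eq_zero.mp h)
  · exact Or.inr (sub_eq_zero.mp h)

/-- The points `a`, `p`, `q`, `b` lie in this order on the line through `p` and `q`. -/
def OrientedThrough {V : Type*} [AddCommGroup V] [Module ℝ V] (p q a b : V) : Prop :=
  ∃ x y : ℝ, x ≤ 0 ∧ 1 ≤ y ∧ a = p + x • (q - p) ∧ b = p + y • (q - p)

lemma orientedThrough_of_lt {V : Type*} [AddCommGroup V] [Module ℝ V] {a b : V} {s t : ℝ}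
    (hs : 0 ≤ s) (hst : s < t) (ht : t ≤ 1) :
    OrientedThrough (a + s • (b - a)) (a + t • (b - a)) a b := by
  have hpos : 0 < t - s := sub_pos.mpr hst
  have hne : t - s ≠ 0 := hpos.ne'
  have hv : a + t • (b - a) - (a + s • (b - a)) = (t - s) • (b - a) := by module
  refine ⟨-s / (t - s), (1 - s) / (t - s), ?_, ?_, ?_, ?_⟩
  · exact div_nonpos_of_nonpos_of_nonneg (by linarith) hpos.le
  · rw [le_div_iff₀ hpos]
    linarith
  · rw [hv, smul_smul, div_mul_cancel₀ _ hne]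
    module
  · rw [hv, smul_smul, div_mul_cancel₀ _ hne]
    module

/-- Two distinct points of a segment, taken in a suitable order, are oriented like its
endpoints. -/
lemma orientedThrough_or_of_mem_segment {V : Type*} [AddCommGroup V] [Module ℝ V] {a b p q : V}
    (hp : p ∈ segment ℝ a b) (hq : q ∈ segment ℝ a b) (hpq : p ≠ q) :
    OrientedThrough p q a b ∨ OrientedThrough q p a b := by
  rw [segment_eq_image'] at hp hq
  obtain ⟨s, hs, rfl⟩ := hp
  obtain ⟨t, ht, rfl⟩ := hq
  have hst : s ≠ t := by
    rintro rfl
    exact hpq rfl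
  rcases hst.lt_or_gt with h | h
  · exact Or.inl (orientedThrough_of_lt hs.1 h ht.2)
  · exact Or.inr (orientedThrough_of_lt ht.1 h hs.2)

/-- A chord of a sphere is determined by an ordered pair of distinct points on it. -/
lemma OrientedThrough.unique_of_mem_sphere {V : Type*} [NormedAddCommGroup V]
    [InnerProductSpace ℝ V] {o p q a b a' b' : V} {r : ℝ} (hpq : p ≠ q)
    (h : OrientedThrough p q a b) (h' : OrientedThrough p q a' b')
    (ha : a ∈ Metric.sphere o r) (hb : b ∈ Metric.sphere o r)
    (ha' : a' ∈ Metric.sphere o r) (hb' : b' ∈ Metric.sphere o r) : a = a' ∧ b = b' := by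
  obtain ⟨x, y, hx, hy, rfl, rfl⟩ := h
  obtain ⟨x', y', hx', hy', rfl, rfl⟩ := h'
  have hA : ‖q - p‖ ^ 2 ≠ 0 := pow_ne_zero 2 (norm_ne_zero_iff.mpr (sub_ne_zero.mpr hpq.symm))
  have key : ∀ z : ℝ, p + z • (q - p) ∈ Metric.sphere o r →
      ‖q - p‖ ^ 2 * z ^ 2 + 2 * inner ℝ (p - o) (q - p) * z + (‖p - o‖ ^ 2 - r ^ 2) = 0 := by
    intro z hz
    rw [mem_sphere_iff_norm, add_sub_right_comm] at hz
    have h := norm_add_sq_real (p - o) (z • (q - p))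
    rw [hz, real_inner_smul_right, norm_smul, mul_pow, Real.norm_eq_abs, sq_abs] at h
    linear_combination -h
  have hxy : x ≠ y := ne_of_lt (by linarith)
  have h₁ := eq_or_eq_of_quadratic_eq hA hxy (key x ha) (key y hb) (key x' ha')
  have h₂ := eq_or_eq_of_quadratic_eq hA hxy (key x ha) (key y hb) (key y' hb')
  have hxx : x' = x := h₁.resolve_right fun h => by linarith
  have hyy : y' = y := h₂.resolve_left fun h => by linarith
  rw [hxx, hyy]
  exact ⟨rfl, rfl⟩

open scoped Classical in
/-- Integral optimum bound in the integrality-gap construction: for `n`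
distinct points on a circle of diameter 1, any set `P` of `k` portals captures
chords of total length (each unordered chord counted twice) at most `k (k-1)`. -/
theorem integral_optimum_bound
    (n k : ℕ) (o : EuclideanSpace ℝ (Fin 2))
    (u : Fin n → EuclideanSpace ℝ (Fin 2)) (hu : Function.Injective u)
    (husph : ∀ i, u i ∈ Metric.sphere o (1 / 2))
    (P : Finset (EuclideanSpace ℝ (Fin 2))) (hP : P.card = k) :
    ∑ ij ∈ (Finset.univ : Finset (Fin n)).offDiag.filter
        (fun ij => 2 ≤ (P.filter (· ∈ segment ℝ (u ij.1) (u ij.2))).card),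
      dist (u ij.1) (u ij.2) ≤ (k : ℝ) * ((k : ℝ) - 1) := by
  set S := (Finset.univ : Finset (Fin n)).offDiag.filter
    (fun ij => 2 ≤ (P.filter (· ∈ segment ℝ (u ij.1) (u ij.2))).card)
  have hdist : ∀ ij ∈ S, dist (u ij.1) (u ij.2) ≤ 1 := by
    intro ij _
    have h₁ := Metric.mem_sphere.mp (husph ij.1)
    have h₂ := Metric.mem_sphere.mp (husph ij.2)
    linarith [dist_triangle_right (u ij.1) (u ij.2) o]
  have hcard : S.card ≤ P.offDiag.card := by
    refine Finset.card_le_card_of_forall_subsingleton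
      (fun ij pq => OrientedThrough pq.1 pq.2 (u ij.1) (u ij.2)) ?_ ?_
    · intro ij hij
      obtain ⟨p, hp, q, hq, hpq⟩ := Finset.one_lt_card.mp (Finset.mem_filter.mp hij).2
      rw [Finset.mem_filter] at hp hq
      rcases orientedThrough_or_of_mem_segment hp.2 hq.2 hpq with h | h
      · exact ⟨(p, q), Finset.mem_offDiag.mpr ⟨hp.1, hq.1, hpq⟩, h⟩
      · exact ⟨(q, p), Finset.mem_offDiag.mpr ⟨hq.1, hp.1, hpq.symm⟩, h⟩
    · rintro pq hpq ij ⟨-, h⟩ ij' ⟨-, h'⟩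
      obtain ⟨h₁, h₂⟩ := h.unique_of_mem_sphere (Finset.mem_offDiag.mp hpq).2.2 h'
        (husph _) (husph _) (husph _) (husph _)
      exact Prod.ext (hu h₁) (hu h₂)
  have hoff : (P.offDiag.card : ℝ) = (k : ℝ) * ((k : ℝ) - 1) := by
    rw [Finset.offDiag_card, hP, Nat.cast_sub (Nat.le_mul_self k), Nat.cast_mul]
    ring
  calc ∑ ij ∈ S, dist (u ij.1) (u ij.2) ≤ S.card • (1 : ℝ) := Finset.sum_le_card_nsmul _ _ _ hdist
    _ = (S.card : ℝ) := by rw [nsmul_eq_mul, mul_one]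
    _ ≤ (P.offDiag.card : ℝ) := by exact_mod_cast hcard
    _ = (k : ℝ) * ((k : ℝ) - 1) := hoff
end

section
/- Endpoint restriction for the one-dimensional TCP (the key structural fact underlying the paper's polynomial-time dynamic program): let a, b : Fin n → ℝ with a j ≤ b j for all j, and define cap as the total captured weight of a portal finset. Then for every finset P of reals there exists a finset Q contained in the set of interval endpoints {a 0, …, a (n−1), b 0, …, b (n−1)} with Q.card ≤ P.card and cap(P) ≤ cap(Q). In particular, some optimal set of k portals consists only of interval endpoints. -/
open scoped Classical

/-- The total captured weight of a one-dimensional TCP instance with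
trajectories `Set.Icc (a j) (b j)` for a portal set `P`: each trajectory
contributes the maximum minus the minimum of the portals lying in its
interval, if at least two portals lie there, and 0 otherwise. -/
noncomputable def capturedWeight (n : ℕ) (a b : Fin n → ℝ) (P : Finset ℝ) : ℝ :=
  ∑ j : Fin n,
    if h : 2 ≤ (P.filter (· ∈ Set.Icc (a j) (b j))).card then
      (P.filter (· ∈ Set.Icc (a j) (b j))).max' (Finset.card_pos.mp (by omega)) -
      (P.filter (· ∈ Set.Icc (a j) (b j))).min' (Finset.card_pos.mp (by omega))
    else 0

/-- The captured weight of the single trajectory `Set.Icc u v`. -/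
noncomputable def trajectoryWeight (u v : ℝ) (P : Finset ℝ) : ℝ :=
  if h : 2 ≤ (P.filter (· ∈ Set.Icc u v)).card then
    (P.filter (· ∈ Set.Icc u v)).max' (Finset.card_pos.mp (by omega)) -
    (P.filter (· ∈ Set.Icc u v)).min' (Finset.card_pos.mp (by omega))
  else 0

theorem capturedWeight_eq_sum (n : ℕ) (a b : Fin n → ℝ) (P : Finset ℝ) :
    capturedWeight n a b P = ∑ j, trajectoryWeight (a j) (b j) P := rfl

theorem trajectoryWeight_nonneg (u v : ℝ) (P : Finset ℝ) : 0 ≤ trajectoryWeight u v P := by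
  unfold trajectoryWeight
  split_ifs with h
  · exact sub_nonneg.mpr (Finset.min'_le_max' _ _)
  · exact le_rfl

theorem sub_le_trajectoryWeight {u v x y : ℝ} {P : Finset ℝ} (hx : x ∈ P) (hy : y ∈ P)
    (hxI : x ∈ Set.Icc u v) (hyI : y ∈ Set.Icc u v) : x - y ≤ trajectoryWeight u v P := by
  rcases eq_or_ne x y with rfl | hne
  · simpa using trajectoryWeight_nonneg u v P
  have hx' := Finset.mem_filter.mpr ⟨hx, hxI⟩
  have hy' := Finset.mem_filter.mpr ⟨hy, hyI⟩
  have h : 2 ≤ (P.filter (· ∈ Set.Icc u v)).card :=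
    Finset.one_lt_card.mpr ⟨x, hx', y, hy', hne⟩
  unfold trajectoryWeight
  rw [dif_pos h]
  exact sub_le_sub (Finset.le_max' _ _ hx') (Finset.min'_le _ _ hy')

theorem trajectoryWeight_le {u v c : ℝ} {P : Finset ℝ} (hc : 0 ≤ c)
    (h : ∀ x ∈ P, ∀ y ∈ P, x ∈ Set.Icc u v → y ∈ Set.Icc u v → x - y ≤ c) :
    trajectoryWeight u v P ≤ c := by
  unfold trajectoryWeight
  split_ifs with h2
  · have hne := Finset.card_pos.mp (Nat.lt_of_lt_of_le Nat.zero_lt_two h2)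
    have hx := Finset.mem_filter.mp (Finset.max'_mem _ hne)
    have hy := Finset.mem_filter.mp (Finset.min'_mem _ hne)
    exact h _ hx.1 _ hy.1 hx.2 hy.2
  · exact hc

/-- A portal lying in no trajectory can be dropped. -/
theorem trajectoryWeight_le_erase {u v p : ℝ} (P : Finset ℝ) (hp : p ∉ Set.Icc u v) :
    trajectoryWeight u v P ≤ trajectoryWeight u v (P.erase p) := by
  refine trajectoryWeight_le (trajectoryWeight_nonneg _ _ _) fun x hx y hy hxI hyI => ?_
  refine sub_le_trajectoryWeight (Finset.mem_erase.mpr ⟨?_, hx⟩)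
    (Finset.mem_erase.mpr ⟨?_, hy⟩) hxI hyI
  · rintro rfl; exact hp hxI
  · rintro rfl; exact hp hyI

/-- The captured weight is convex in the position of a portal, as long as a trajectory
containing that portal contains the whole range of positions. -/
theorem trajectoryWeight_le_convex_comb {u v p l r s t : ℝ} (P : Finset ℝ) (hs : 0 ≤ s)
    (ht : 0 ≤ t) (hst : s + t = 1) (hp : s * l + t * r = p)
    (hl : p ∈ Set.Icc u v → l ∈ Set.Icc u v) (hr : p ∈ Set.Icc u v → r ∈ Set.Icc u v) :
    trajectoryWeight u v P ≤ s * trajectoryWeight u v (insert l (P.erase p)) +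
      t * trajectoryWeight u v (insert r (P.erase p)) := by
  have key : ∀ q : ℝ, (p ∈ Set.Icc u v → q ∈ Set.Icc u v) → ∀ x ∈ P, x ∈ Set.Icc u v →
      (if x = p then q else x) ∈ insert q (P.erase p) ∧
        (if x = p then q else x) ∈ Set.Icc u v := by
    intro q hq x hx hxI
    split_ifs with h
    · exact ⟨Finset.mem_insert_self _ _, hq (h ▸ hxI)⟩
    · exact ⟨Finset.mem_insert_of_mem (Finset.mem_erase.mpr ⟨h, hx⟩), hxI⟩
  have comb : ∀ x : ℝ, s * (if x = p then l else x) + t * (if x = p then r else x) = x := by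
    intro x
    split_ifs with h
    · rw [hp, h]
    · rw [← add_mul, hst, one_mul]
  refine trajectoryWeight_le (add_nonneg (mul_nonneg hs (trajectoryWeight_nonneg _ _ _))
    (mul_nonneg ht (trajectoryWeight_nonneg _ _ _))) fun x hx y hy hxI hyI => ?_
  have h₁ := sub_le_trajectoryWeight (key l hl x hx hxI).1 (key l hl y hy hyI).1
    (key l hl x hx hxI).2 (key l hl y hy hyI).2
  have h₂ := sub_le_trajectoryWeight (key r hr x hx hxI).1 (key r hr y hy hyI).1
    (key r hr x hx hxI).2 (key r hr y hy hyI).2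
  have h₃ := mul_le_mul_of_nonneg_left h₁ hs
  have h₄ := mul_le_mul_of_nonneg_left h₂ ht
  linarith [comb x, comb y]

/-- If `E` is a finite set containing all interval endpoints, any portal can be removed or
moved into `E` without decreasing the captured weight. -/
theorem exists_sdiff_subset_erase_capturedWeight_le (n : ℕ) (a b : Fin n → ℝ)
    {E P : Finset ℝ} {p : ℝ}
    (ha : ∀ j, a j ∈ E) (hb : ∀ j, b j ∈ E) (hpP : p ∈ P) :
    ∃ Q : Finset ℝ, Q.card ≤ P.card ∧ Q \ E ⊆ (P \ E).erase p ∧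
      capturedWeight n a b P ≤ capturedWeight n a b Q := by
  have insert_ok : ∀ q ∈ E, (insert q (P.erase p)).card ≤ P.card ∧
      insert q (P.erase p) \ E ⊆ (P \ E).erase p := by
    intro q hq
    refine ⟨(Finset.card_insert_le _ _).trans (Finset.card_erase_add_one hpP).le, ?_⟩
    intro x hx
    simp only [Finset.mem_sdiff, Finset.mem_insert, Finset.mem_erase] at hx ⊢
    rcases hx with ⟨rfl | ⟨h₁, h₂⟩, h₃⟩
    · exact absurd hq h₃
    · exact ⟨h₁, h₂, h₃⟩
  by_cases hout : ∀ j, p ∉ Set.Icc (a j) (b j)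
  · refine ⟨P.erase p, Finset.card_erase_le, (Finset.erase_sdiff_comm _ _ _).le, ?_⟩
    exact Finset.sum_le_sum fun j _ => trajectoryWeight_le_erase P (hout j)
  push Not at hout
  obtain ⟨i, hi⟩ := hout
  have hL : (E.filter (· ≤ p)).Nonempty := ⟨a i, Finset.mem_filter.mpr ⟨ha i, hi.1⟩⟩
  have hR : (E.filter (p ≤ ·)).Nonempty := ⟨b i, Finset.mem_filter.mpr ⟨hb i, hi.2⟩⟩
  obtain ⟨l, hl, hlmax⟩ := Finset.exists_max_image _ id hL
  obtain ⟨r, hr, hrmin⟩ := Finset.exists_min_image _ id hR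
  simp only [Finset.mem_filter, id, and_imp] at hl hlmax hr hrmin
  obtain ⟨s, t, hs, ht, hst, hp⟩ : p ∈ segment ℝ l r := by
    rw [segment_eq_Icc (hl.2.trans hr.2)]
    exact ⟨hl.2, hr.2⟩
  have hcomb : capturedWeight n a b P ≤ s * capturedWeight n a b (insert l (P.erase p)) +
      t * capturedWeight n a b (insert r (P.erase p)) := by
    simp only [capturedWeight_eq_sum, Finset.mul_sum, ← Finset.sum_add_distrib]
    refine Finset.sum_le_sum fun j _ =>
      trajectoryWeight_le_convex_comb P hs ht hst (by simpa using hp) ?_ ?_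
    · exact fun h => ⟨hlmax _ (ha j) h.1, hl.2.trans h.2⟩
    · exact fun h => ⟨h.1.trans hr.2, hrmin _ (hb j) h.2⟩
  rcases le_max_iff.mp (hcomb.trans (Convex.combo_le_max _ _ hs ht hst)) with h | h
  · exact ⟨_, (insert_ok l hl.1).1, (insert_ok l hl.1).2, h⟩
  · exact ⟨_, (insert_ok r hr.1).1, (insert_ok r hr.1).2, h⟩

theorem exists_subset_capturedWeight_le (n : ℕ) (a b : Fin n → ℝ) {E : Finset ℝ}
    (ha : ∀ j, a j ∈ E) (hb : ∀ j, b j ∈ E) (P : Finset ℝ) :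
    ∃ Q : Finset ℝ, Q ⊆ E ∧ Q.card ≤ P.card ∧
      capturedWeight n a b P ≤ capturedWeight n a b Q := by
  by_cases hPE : P ⊆ E
  · exact ⟨P, hPE, le_rfl, le_rfl⟩
  obtain ⟨p, hpP, hpE⟩ := Finset.not_subset.mp hPE
  obtain ⟨R, hcard, hsub, hle⟩ := exists_sdiff_subset_erase_capturedWeight_le n a b ha hb hpP
  have hlt : (R \ E).card < (P \ E).card :=
    (Finset.card_le_card hsub).trans_lt
      (Finset.card_erase_lt_of_mem (Finset.mem_sdiff.mpr ⟨hpP, hpE⟩))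
  obtain ⟨Q, hQE, hQcard, hQle⟩ := exists_subset_capturedWeight_le n a b ha hb R
  exact ⟨Q, hQE, hQcard.trans hcard, hle.trans hQle⟩
termination_by (P \ E).card

/-- Endpoint restriction for the one-dimensional TCP: every portal set can be
replaced by a set of at most as many interval endpoints capturing at least as
much weight. -/
theorem exists_endpoint_portals (n : ℕ) (a b : Fin n → ℝ) (hab : ∀ j, a j ≤ b j)
    (P : Finset ℝ) :
    ∃ Q : Finset ℝ,
      Q ⊆ Finset.univ.image a ∪ Finset.univ.image b ∧
      Q.card ≤ P.card ∧
      capturedWeight n a b P ≤ capturedWeight n a b Q := by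
  exact exists_subset_capturedWeight_le n a b
    (fun j => Finset.mem_union_left _ (Finset.mem_image_of_mem a (Finset.mem_univ j)))
    (fun j => Finset.mem_union_right _ (Finset.mem_image_of_mem b (Finset.mem_univ j))) P
end

section
/- Gap decomposition of the one-dimensional captured weight (correctness of the summation used in the paper's dynamic-programming recursion): let a, b : Fin n → ℝ with a j ≤ b j for all j, let P be a finset of reals, and let L = P.sort (· ≤ ·) be its sorted list (strictly increasing, of length m). Then cap(P) = ∑_{t=0}^{m−2} (L[t+1] − L[t]) * |{j : Fin n | a j ≤ L[t] ∧ L[t+1] ≤ b j}|, i.e., the total captured weight equals the sum over consecutive portal pairs (x, x') of (x' − x) times the number of trajectories whose interval contains [x, x']. -/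
open scoped Classical

/-- The part of the gap sum of the sorted list of `P` carried by the gaps inside `[a, b]` telescopes
to the distance between the extreme points of `P` in `[a, b]`. -/
theorem sum_sort_gaps_eq_max'_sub_min' (a b : ℝ) (P : Finset ℝ)
    (hS : (P.filter (· ∈ Set.Icc a b)).Nonempty) :
    (∑ t ∈ Finset.range ((P.sort (· ≤ ·)).length - 1),
      if a ≤ (P.sort (· ≤ ·)).getD t 0 ∧ (P.sort (· ≤ ·)).getD (t + 1) 0 ≤ b then
        (P.sort (· ≤ ·)).getD (t + 1) 0 - (P.sort (· ≤ ·)).getD t 0 else 0) =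
      (P.filter (· ∈ Set.Icc a b)).max' hS - (P.filter (· ∈ Set.Icc a b)).min' hS := by
  set L := P.sort (· ≤ ·) with hL
  set S := P.filter (· ∈ Set.Icc a b) with hSdef
  have hmono : ∀ i j, i < j → j < L.length → L.getD i 0 < L.getD j 0 := by
    intro i j hij hj
    rw [List.getD_eq_getElem _ _ hj, List.getD_eq_getElem _ _ (hij.trans hj)]
    exact P.sortedLT_sort.pairwise.rel_get_of_lt (a := ⟨i, hij.trans hj⟩) (b := ⟨j, hj⟩) hij
  have hle : ∀ i j, i ≤ j → j < L.length → L.getD i 0 ≤ L.getD j 0 := by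
    intro i j hij hj
    rcases hij.eq_or_lt with rfl | h
    · exact le_rfl
    · exact (hmono i j h hj).le
  have hidx : ∀ x ∈ S, ∃ i < L.length, L.getD i 0 = x := by
    intro x hx
    have hxL : x ∈ L := (Finset.mem_sort _).2 (Finset.mem_filter.1 hx).1
    obtain ⟨i, hi, rfl⟩ := List.getElem_of_mem hxL
    exact ⟨i, hi, List.getD_eq_getElem _ _ hi⟩
  have hmem : ∀ i < L.length, a ≤ L.getD i 0 → L.getD i 0 ≤ b → L.getD i 0 ∈ S := by
    intro i hi h₁ h₂
    refine Finset.mem_filter.2 ⟨?_, h₁, h₂⟩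
    rw [List.getD_eq_getElem _ _ hi]
    exact (Finset.mem_sort _).1 (List.getElem_mem hi)
  obtain ⟨p, hp, hpmin⟩ := hidx _ (S.min'_mem hS)
  obtain ⟨q, hq, hqmax⟩ := hidx _ (S.max'_mem hS)
  have hap : a ≤ L.getD p 0 := hpmin ▸ (Finset.mem_filter.1 (S.min'_mem hS)).2.1
  have hqb : L.getD q 0 ≤ b := hqmax ▸ (Finset.mem_filter.1 (S.max'_mem hS)).2.2
  have hpq : p ≤ q := by
    by_contra! h
    have h₁ := hmono q p h hp
    have h₂ := S.min'_le_max' hS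
    linarith
  have hfilter : (Finset.range (L.length - 1)).filter
      (fun t => a ≤ L.getD t 0 ∧ L.getD (t + 1) 0 ≤ b) = Finset.Ico p q := by
    ext t
    simp only [Finset.mem_filter, Finset.mem_range, Finset.mem_Ico]
    constructor
    · rintro ⟨ht, h₁, h₂⟩
      have hlt := hmono t (t + 1) (by omega) (by omega)
      have hmin := S.min'_le _ (hmem t (by omega) h₁ (hlt.le.trans h₂))
      have hmax := S.le_max' _ (hmem (t + 1) (by omega) (h₁.trans hlt.le) h₂)
      constructor
      · by_contra! h
        have := hmono t p h hp
        linarith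
      · by_contra! h
        have := hmono q (t + 1) (by omega) (by omega)
        linarith
    · rintro ⟨h₁, h₂⟩
      exact ⟨by omega, hap.trans (hle p t h₁ (by omega)), (hle (t + 1) q h₂ hq).trans hqb⟩
  rw [← Finset.sum_filter, hfilter, Finset.sum_Ico_sub (fun t => L.getD t 0) hpq, hpmin, hqmax]

/-- No gap of the sorted list of `P` lies inside `[a, b]` when `[a, b]` contains no point of `P`. -/
theorem sum_sort_gaps_eq_zero (a b : ℝ) (P : Finset ℝ)
    (hS : ¬ (P.filter (· ∈ Set.Icc a b)).Nonempty) :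
    (∑ t ∈ Finset.range ((P.sort (· ≤ ·)).length - 1),
      if a ≤ (P.sort (· ≤ ·)).getD t 0 ∧ (P.sort (· ≤ ·)).getD (t + 1) 0 ≤ b then
        (P.sort (· ≤ ·)).getD (t + 1) 0 - (P.sort (· ≤ ·)).getD t 0 else 0) = 0 := by
  refine Finset.sum_eq_zero fun t ht => if_neg ?_
  rintro ⟨h₁, h₂⟩
  have ht' : t + 1 < (P.sort (· ≤ ·)).length := by
    have := Finset.mem_range.1 ht
    omega
  rw [List.getD_eq_getElem _ _ (by omega)] at h₁
  rw [List.getD_eq_getElem _ _ ht'] at h₂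
  have hlt := P.sortedLT_sort.pairwise.rel_get_of_lt
    (a := ⟨t, by omega⟩) (b := ⟨t + 1, ht'⟩) (Nat.lt_succ_self t)
  exact hS ⟨_, Finset.mem_filter.2
    ⟨(Finset.mem_sort _).1 (List.getElem_mem ht'), h₁.trans hlt.le, h₂⟩⟩

/-- Gap decomposition of the one-dimensional captured weight: if `L` is the
increasingly sorted list of the portal set `P`, then the total captured weight
equals the sum over consecutive portal pairs `(L[t], L[t+1])` of the gap length
`L[t+1] - L[t]` times the number of trajectory intervals containing
`[L[t], L[t+1]]`. -/
theorem capturedWeight_gap_decomposition (n : ℕ) (a b : Fin n → ℝ)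
    (hab : ∀ j, a j ≤ b j) (P : Finset ℝ) :
    capturedWeight n a b P =
      ∑ t ∈ Finset.range ((P.sort (· ≤ ·)).length - 1),
        ((P.sort (· ≤ ·)).getD (t + 1) 0 - (P.sort (· ≤ ·)).getD t 0) *
          ((Finset.univ : Finset (Fin n)).filter
            (fun j => a j ≤ (P.sort (· ≤ ·)).getD t 0 ∧
                      (P.sort (· ≤ ·)).getD (t + 1) 0 ≤ b j)).card := by
  simp_rw [Finset.card_filter, Nat.cast_sum, Finset.mul_sum]
  rw [Finset.sum_comm, capturedWeight]
  refine Finset.sum_congr rfl fun j _ => ?_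
  simp only [Nat.cast_ite, Nat.cast_one, Nat.cast_zero, mul_ite, mul_one, mul_zero]
  by_cases hS : (P.filter (· ∈ Set.Icc (a j) (b j))).Nonempty
  · rw [sum_sort_gaps_eq_max'_sub_min' _ _ _ hS]
    split_ifs with h
    · rfl
    · have hcard : (P.filter (· ∈ Set.Icc (a j) (b j))).card ≤ 1 := by omega
      rw [Finset.card_le_one.1 hcard _ (Finset.max'_mem _ hS) _ (Finset.min'_mem _ hS), sub_self]
  · rw [sum_sort_gaps_eq_zero _ _ _ hS, dif_neg]
    rw [Finset.not_nonempty_iff_eq_empty.1 hS]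
    simp
end

section
/- Greedy endpoint lower bound for the one-dimensional TCP: let a, b : Fin n → ℝ with a j ≤ b j for all j, and let S be any finset of indices j : Fin n. Set Q = (S.image a) ∪ (S.image b), the finset of endpoints of the trajectories in S. Then Q.card ≤ 2 * S.card and cap(Q) ≥ ∑_{j ∈ S} (b j − a j); i.e., placing portals at the at most 2|S| endpoints of the trajectories in S captures at least the total weight of those trajectories. (This is the integral solution used in the paper's proofs of the Δ-approximation and the k/⌊k/2⌋ integrality-gap bound, which capture the ⌊k/2⌋ longest trajectories with at most k portals.) -/
open scoped Classical

/-- A trajectory both of whose endpoints are portals is captured entirely. -/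
theorem sub_le_capture_of_mem {P : Finset ℝ} {x y : ℝ} (hxy : x ≤ y) (hx : x ∈ P) (hy : y ∈ P) :
    y - x ≤ if h : 2 ≤ (P.filter (· ∈ Set.Icc x y)).card then
      (P.filter (· ∈ Set.Icc x y)).max' (Finset.card_pos.mp (by omega)) -
      (P.filter (· ∈ Set.Icc x y)).min' (Finset.card_pos.mp (by omega))
    else 0 := by
  have hx' : x ∈ P.filter (· ∈ Set.Icc x y) := by simp [hx, hxy]
  have hy' : y ∈ P.filter (· ∈ Set.Icc x y) := by simp [hy, hxy]
  split_ifs with h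
  · exact sub_le_sub (Finset.le_max' _ _ hy') (Finset.min'_le _ _ hx')
  · have := Finset.card_le_one.mp (by omega) x hx' y hy'
    simp [this]

/-- The captured weight of a single trajectory is nonnegative. -/
theorem capture_nonneg (P : Finset ℝ) (x y : ℝ) :
    0 ≤ if h : 2 ≤ (P.filter (· ∈ Set.Icc x y)).card then
      (P.filter (· ∈ Set.Icc x y)).max' (Finset.card_pos.mp (by omega)) -
      (P.filter (· ∈ Set.Icc x y)).min' (Finset.card_pos.mp (by omega))
    else 0 := by
  split_ifs with h
  · exact sub_nonneg.mpr (Finset.min'_le_max' _ _)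
  · exact le_rfl

/-- Greedy endpoint lower bound: placing portals at the at most `2 |S|`
endpoints of the trajectories indexed by `S` captures at least the total
weight of those trajectories. -/
theorem greedy_endpoint_bound (n : ℕ) (a b : Fin n → ℝ) (hab : ∀ j, a j ≤ b j)
    (S : Finset (Fin n)) :
    (S.image a ∪ S.image b).card ≤ 2 * S.card ∧
    ∑ j ∈ S, (b j - a j) ≤ capturedWeight n a b (S.image a ∪ S.image b) := by
  constructor
  · have h := Finset.card_union_le (S.image a) (S.image b)
    have ha : (S.image a).card ≤ S.card := Finset.card_image_le
    have hb : (S.image b).card ≤ S.card := Finset.card_image_le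
    omega
  · unfold capturedWeight
    refine (Finset.sum_le_sum fun j hj => ?_).trans
      (Finset.sum_le_univ_sum_of_nonneg fun j => capture_nonneg _ (a j) (b j))
    exact sub_le_capture_of_mem (hab j)
      (Finset.mem_union_left _ (Finset.mem_image_of_mem a hj))
      (Finset.mem_union_right _ (Finset.mem_image_of_mem b hj))
end
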